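/- The word 1010 is the shortest Ham-isometric word that is not tilde-isometric: 1010 is Ham-isometric, 1010 is not tilde-isometric, and every Ham-isometric binary word of length at most 3 is tilde-isometric. -/

import Mathlib

/-- One tilde edit step: a replacement (flip one symbol) or a swap of two
adjacent distinct symbols. -/
inductive TStep : List Bool → List Bool → Prop
  | repl (x y : List Bool) (a : Bool) : TStep (x ++ a :: y) (x ++ (!a) :: y)
  | swap (x y : List Bool) (a : Bool) : TStep (x ++ a :: (!a) :: y) (x ++ (!a) :: a :: y)

/-- `reach step h u v` : `v` can be obtained from `u` by a chain of `h` steps. -/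
def reach (step : List Bool → List Bool → Prop) : ℕ → List Bool → List Bool → Prop
  | 0 => Eq
  | h + 1 => fun u v => ∃ w, step u w ∧ reach step h w v

/-- The tilde-distance: the minimum number of replacements and swaps needed to
transform `u` into `v`. -/
noncomputable def tildeDist (u v : List Bool) : ℕ := sInf {h | reach TStep h u v}

theorem TStep.symm {u v : List Bool} (h : TStep u v) : TStep v u := by
  cases h with
  | repl x y a => simpa using TStep.repl x y (!a)
  | swap x y a => simpa using TStep.swap x y (!a)

theorem reach_snoc {step : List Bool → List Bool → Prop} :
    ∀ {h : ℕ} {u v w : List Bool}, reach step h u v → step v w → reach step (h + 1) u w := by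
  intro h
  induction h with
  | zero => intro u v w r s; exact ⟨w, r ▸ s, rfl⟩
  | succ h ih => intro u v w r s; obtain ⟨z, su, rz⟩ := r; exact ⟨z, su, ih rz s⟩

theorem reach_symm : ∀ {h : ℕ} {u v : List Bool}, reach TStep h u v → reach TStep h v u := by
  intro h
  induction h with
  | zero => intro u v r; exact r.symm
  | succ h ih => intro u v r; obtain ⟨w, s, rw⟩ := r; exact reach_snoc (ih rw) s.symm

theorem tildeDist_comm (u v : List Bool) : tildeDist u v = tildeDist v u := by
  unfold tildeDist
  congr 1
  ext h
  exact ⟨fun r => reach_symm r, fun r => reach_symm r⟩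

theorem tildeDist_self (u : List Bool) : tildeDist u u = 0 :=
  Nat.sInf_eq_zero.mpr (Or.inl rfl)

/-- The Hamming distance: the number of positions at which `u` and `v` differ. -/
def hammDist (u v : List Bool) : ℕ := ((u.zip v).filter fun p => p.1 != p.2).length

theorem hammDist_comm : ∀ u v : List Bool, hammDist u v = hammDist v u
  | [], [] => rfl
  | [], _ :: _ => rfl
  | _ :: _, [] => rfl
  | a :: u, b :: v => by
    cases a <;> cases b <;>
      simp [hammDist, List.filter_cons, hammDist_comm u v, hammDist] <;>
      simpa [hammDist] using hammDist_comm u v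

theorem hammDist_self : ∀ u : List Bool, hammDist u u = 0
  | [] => rfl
  | a :: u => by simpa [hammDist, List.filter_cons] using hammDist_self u

/-- Binary words of length `n`. -/
abbrev Word (n : ℕ) := {w : List Bool // w.length = n}

/-- The `n`-tilde-hypercube: vertices are the binary words of length `n`, and
two vertices are adjacent iff their tilde-distance is `1`. -/
noncomputable def tildeCube (n : ℕ) : SimpleGraph (Word n) where
  Adj u v := tildeDist u.val v.val = 1
  symm := by constructor; intro u v h; rwa [tildeDist_comm]
  loopless := by constructor; intro u h; rw [tildeDist_self] at h; exact one_ne_zero h.symm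

/-- The `n`-hypercube: vertices are the binary words of length `n`, and
two vertices are adjacent iff their Hamming distance is `1`. -/
def hamCube (n : ℕ) : SimpleGraph (Word n) where
  Adj u v := hammDist u.val v.val = 1
  symm := by constructor; intro u v h; rwa [hammDist_comm]
  loopless := by constructor; intro u h; rw [hammDist_self] at h; exact one_ne_zero h.symm

/-- `f` is tilde-isometric. -/
def TildeIsometric (f : List Bool) : Prop :=
  ∀ n : ℕ, f.length ≤ n → ∀ u v : List Bool, u.length = n → v.length = n →
    ¬ f <:+: u → ¬ f <:+: v →
    ∃ w : ℕ → List Bool, w 0 = u ∧ w (tildeDist u v) = v ∧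
      (∀ k < tildeDist u v, tildeDist (w k) (w (k + 1)) = 1) ∧
      (∀ k ≤ tildeDist u v, ¬ f <:+: w k)

/-- `f` is Ham-isometric. -/
def HamIsometric (f : List Bool) : Prop :=
  ∀ u v : List Bool, u.length = v.length →
    ¬ f <:+: u → ¬ f <:+: v →
    ∃ w : ℕ → List Bool, w 0 = u ∧ w (hammDist u v) = v ∧
      (∀ k ≤ hammDist u v, (w k).length = u.length) ∧
      (∀ k < hammDist u v, hammDist (w k) (w (k + 1)) = 1) ∧
      (∀ k ≤ hammDist u v, ¬ f <:+: w k)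
/-- The set of words of length `n` avoiding the factor `11`. -/
def fibFree (n : ℕ) : Set (Word n) := {w | ¬ [true, true] <:+: w.val}

/-- The `n`-tilde-Fibonacci cube: the subgraph of the tilde-hypercube induced by
the words avoiding the factor `11`. -/
noncomputable def tildeFibCube (n : ℕ) : SimpleGraph (fibFree n) :=
  (tildeCube n).induce (fibFree n)

/-- The `n`-Fibonacci cube: the subgraph of the hypercube induced by
the words avoiding the factor `11`. -/
def fibCube (n : ℕ) : SimpleGraph (fibFree n) :=
  (hamCube n).induce (fibFree n)

/-- Explicit greedy tilde distance. -/
def gD : List Bool → List Bool → ℕ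
  | a :: a' :: u, b :: b' :: v =>
    if a = b then gD (a' :: u) (b' :: v)
    else if a' = b ∧ b' = a then 1 + gD u v
    else 1 + gD (a' :: u) (b' :: v)
  | [a], b :: _ => if a = b then 0 else 1
  | a :: _, [b] => if a = b then 0 else 1
  | _, _ => 0

theorem gD_nil (u v : List Bool) (h : u.length = v.length) (hu : u = [] ∨ v = []) : gD u v = 0 := by
  rcases hu with rfl | rfl
  · cases v <;> simp_all [gD]
  · cases u <;> simp_all [gD]

theorem gD_same (a : Bool) (u v : List Bool) (h : u.length = v.length) :
    gD (a :: u) (a :: v) = gD u v := by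
  cases u <;> cases v <;> simp_all [gD]

theorem gD_swap (a : Bool) (u v : List Bool) :
    gD (a :: (!a) :: u) ((!a) :: a :: v) = 1 + gD u v := by
  cases a <;> simp [gD]

theorem gD_repl (a : Bool) (u v : List Bool) (h : u.length = v.length)
    (hn : ¬ ∃ u' v', u = (!a) :: u' ∧ v = a :: v') :
    gD (a :: u) ((!a) :: v) = 1 + gD u v := by
  cases u <;> cases v <;> simp_all [gD]

theorem gD_cons_le : ∀ (n : ℕ) (a b : Bool) (u v : List Bool), u.length = n → v.length = n →
    gD u v ≤ gD (a :: u) (b :: v) ∧ gD (a :: u) (b :: v) ≤ gD u v + 1 := by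
  intro n
  induction n using Nat.strong_induction_on with
  | _ n ih =>
  intro a b u v hu hv
  have huv : u.length = v.length := by omega
  by_cases hab : a = b
  · subst hab
    rw [gD_same _ _ _ huv]; omega
  · obtain rfl : b = !a := by cases a <;> cases b <;> simp_all
    by_cases hn : ∃ u' v', u = (!a) :: u' ∧ v = a :: v'
    · obtain ⟨u', v', rfl, rfl⟩ := hn
      rw [gD_swap]
      simp at hu hv
      have := ih u'.length (by omega) (!a) a u' v' rfl (by omega)
      omega
    · rw [gD_repl a u v huv hn]; omega

theorem TStep.length {u w : List Bool} (h : TStep u w) : u.length = w.length := by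
  cases h <;> simp

theorem TStep.ne {u w : List Bool} (h : TStep u w) : u ≠ w := by
  cases h <;> simp

theorem TStep.cons (a : Bool) {u w : List Bool} (h : TStep u w) : TStep (a :: u) (a :: w) := by
  cases h with
  | repl x y b => exact TStep.repl (a :: x) y b
  | swap x y b => exact TStep.swap (a :: x) y b

theorem TStep.app (x : List Bool) {u w : List Bool} (h : TStep u w) : TStep (x ++ u) (x ++ w) := by
  induction x with
  | nil => exact h
  | cons a x ih => exact ih.cons a

theorem TStep.cons_cases {a b : Bool} {u w : List Bool} (h : TStep (a :: u) (b :: w)) :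
    (a = b ∧ TStep u w) ∨ (b = !a ∧ u = w) ∨
    (b = !a ∧ ∃ t, u = (!a) :: t ∧ w = a :: t) := by
  generalize hp : a :: u = p at h
  generalize hq : b :: w = q at h
  cases h with
  | repl x y c =>
    cases x with
    | nil => simp at hp hq; right; left; simp_all
    | cons d x =>
      simp at hp hq; left
      obtain ⟨rfl, rfl⟩ := hp
      obtain ⟨rfl, rfl⟩ := hq
      exact ⟨rfl, TStep.repl _ _ _⟩
  | swap x y c =>
    cases x with
    | nil => simp at hp hq; right; right; simp_all
    | cons d x =>
      simp at hp hq; left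
      obtain ⟨rfl, rfl⟩ := hp
      obtain ⟨rfl, rfl⟩ := hq
      exact ⟨rfl, TStep.swap _ _ _⟩

theorem gD_lip : ∀ (n : ℕ) (u w v : List Bool), u.length = n → v.length = n → TStep u w →
    gD u v ≤ gD w v + 1 := by
  intro n
  induction n using Nat.strong_induction_on with
  | _ n ih =>
  intro u w v hu hv hs
  have hl := hs.length
  match u, w, v, hu, hv, hs, hl with
  | [], [], _, _, _, hs, _ => exact absurd rfl hs.ne
  | a :: u, b :: w, c :: v, hu, hv, hs, hl =>
    simp at hu hv hl
    have huv : u.length = v.length := by omega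
    have hwv : w.length = v.length := by omega
    have e1 := gD_cons_le v.length a c u v huv rfl
    have e2 := gD_cons_le v.length b c w v hwv rfl
    rcases hs.cons_cases with ⟨rfl, h⟩ | ⟨rfl, rfl⟩ | ⟨rfl, t, rfl, rfl⟩
    · have h0 := ih u.length (by omega) u w v rfl huv.symm h
      by_cases hac : a = c
      · subst hac; rw [gD_same _ _ _ huv, gD_same _ _ _ hwv]; exact h0
      · obtain rfl : c = !a := by cases a <;> cases c <;> simp_all
        by_cases hn : ∃ w' v', w = (!a) :: w' ∧ v = a :: v'
        · obtain ⟨w', v', rfl, rfl⟩ := hn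
          rw [gD_swap]
          obtain ⟨d, u', rfl⟩ : ∃ d u', u = d :: u' :=
            List.exists_cons_of_ne_nil (by rintro rfl; simp at huv)
          replace huv : u'.length = v'.length := by simpa using huv
          replace hwv : w'.length = v'.length := by simpa using hwv
          replace hu : u'.length + 1 + 1 = n := by simpa using hu
          rcases h.cons_cases with ⟨rfl, h'⟩ | ⟨h1, rfl⟩ | ⟨h1, t, rfl, rfl⟩
          · rw [gD_swap]
            have := ih u'.length (by omega) u' w' v' rfl huv.symm h'
            omega
          · obtain rfl : d = a := by cases a <;> cases d <;> simp_all
            rw [gD_repl _ _ _ (by simp [huv]) (by simp), gD_same _ _ _ huv]; omega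
          · obtain rfl : d = a := by cases a <;> cases d <;> simp_all
            rw [gD_repl _ _ _ (by simp at huv ⊢; omega) (by simp), gD_same _ _ _ huv]
            have := ih ((!d) :: t).length (by simp at hu ⊢; omega) _ (d :: t) v' rfl (by simp at huv ⊢; omega)
              (by simpa using TStep.repl [] t (!d))
            omega
        · rw [gD_repl _ _ _ hwv hn]
          by_cases hn' : ∃ u' v', u = (!a) :: u' ∧ v = a :: v'
          · obtain ⟨u', v', rfl, rfl⟩ := hn'
            rw [gD_swap]
            obtain ⟨d, w', rfl⟩ : ∃ d w', w = d :: w' :=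
              List.exists_cons_of_ne_nil (by rintro rfl; simp at hwv)
            replace huv : u'.length = v'.length := by simpa using huv
            replace hwv : w'.length = v'.length := by simpa using hwv
            replace hu : u'.length + 1 + 1 = n := by simpa using hu
            have hd : d = a := by cases a <;> cases d <;> simp_all
            subst hd
            rw [gD_same _ _ _ hwv]
            rcases h.cons_cases with ⟨h1, h'⟩ | ⟨h1, rfl⟩ | ⟨h1, t, rfl, rfl⟩
            · simp at h1
            · omega
            · have := ih (d :: t).length (by simp at hu ⊢; omega) (d :: t) ((!d) :: t) v' rfl (by simp at huv ⊢; omega)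
                (by simpa using TStep.repl [] t d)
              simp at this ⊢
              omega
          · rw [gD_repl _ _ _ huv hn']; omega
    · omega
    · obtain ⟨d, v, rfl⟩ : ∃ d v', v = d :: v' :=
        List.exists_cons_of_ne_nil (by rintro rfl; simp at huv)
      replace huv : t.length = v.length := by simpa using huv
      have f1 := gD_cons_le v.length (!a) d t v huv rfl
      have f2 := gD_cons_le v.length a d t v huv rfl
      have key : c = a ∧ d = !a ∨ c = !a ∧ d = a ∨ c = a ∧ d = a ∨ c = !a ∧ d = !a := by
        cases a <;> cases c <;> cases d <;> simp
      rcases key with ⟨rfl, rfl⟩ | ⟨rfl, rfl⟩ | ⟨rfl, rfl⟩ | ⟨rfl, rfl⟩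
      · rw [gD_same _ _ _ (by simp [huv]), gD_same _ _ _ huv]
        have := gD_swap (!c) t v
        simp at this
        omega
      · rw [gD_swap, gD_same _ _ _ (by simp [huv]), gD_same _ _ _ huv]; omega
      · rw [gD_same _ _ _ (by simp [huv])]
        have := gD_repl (!d) (d :: t) (d :: v) (by simp [huv]) (by simp)
        simp at this
        rw [gD_same _ _ _ huv] at this
        omega
      · rw [gD_repl _ _ _ (by simp [huv]) (by simp), gD_same _ _ _ huv,
          gD_same _ _ _ (by simp [huv])]
        omega

theorem reach_length : ∀ {h : ℕ} {u v : List Bool}, reach TStep h u v → u.length = v.length := by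
  intro h
  induction h with
  | zero => intro u v r; exact congrArg _ r
  | succ h ih => intro u v ⟨w, s, r⟩; rw [s.length, ih r]

theorem gD_self (u : List Bool) : gD u u = 0 := by
  induction u with
  | nil => rfl
  | cons a u ih => rw [gD_same _ _ _ rfl, ih]

theorem gD_le_of_reach : ∀ {h : ℕ} {u v : List Bool}, reach TStep h u v → gD u v ≤ h := by
  intro h
  induction h with
  | zero => intro u v r; cases r; rw [gD_self]
  | succ h ih =>
    intro u v r
    have hl := reach_length r
    obtain ⟨w, s, r⟩ := r
    have := gD_lip _ u w v rfl hl.symm s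
    have := ih r
    omega

theorem reach_app (x : List Bool) : ∀ {h : ℕ} {u v : List Bool}, reach TStep h u v →
    reach TStep h (x ++ u) (x ++ v) := by
  intro h
  induction h with
  | zero => intro u v r; cases r; rfl
  | succ h ih => intro u v ⟨w, s, r⟩; exact ⟨x ++ w, s.app x, ih r⟩

theorem reach_gD : ∀ (n : ℕ) (u v : List Bool), u.length = n → v.length = n →
    reach TStep (gD u v) u v := by
  intro n
  induction n using Nat.strong_induction_on with
  | _ n ih =>
  intro u v hu hv
  match u, v, hu, hv with
  | [], v, hu, hv =>
    obtain rfl : v = [] := List.length_eq_zero_iff.mp (by simp at hu; omega)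
    rfl
  | a :: u, [], hu, hv => simp at hu hv; omega
  | a :: u, b :: v, hu, hv =>
    simp at hu hv
    have huv : u.length = v.length := by omega
    have h0 := ih u.length (by omega) u v rfl huv.symm
    by_cases hab : a = b
    · subst hab; rw [gD_same _ _ _ huv]; exact reach_app [a] h0
    · obtain rfl : b = !a := by cases a <;> cases b <;> simp_all
      by_cases hn : ∃ u' v', u = (!a) :: u' ∧ v = a :: v'
      · obtain ⟨u', v', rfl, rfl⟩ := hn
        simp at huv hu
        rw [gD_swap, Nat.add_comm]
        exact ⟨_, TStep.swap [] u' a, reach_app [!a, a] (ih _ (by omega) u' v' rfl huv.symm)⟩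
      · rw [gD_repl _ _ _ huv hn, Nat.add_comm]
        exact ⟨_, TStep.repl [] u a, reach_app [!a] h0⟩

theorem tildeDist_eq {u v : List Bool} (h : u.length = v.length) : tildeDist u v = gD u v := by
  have hr := reach_gD _ u v rfl h.symm
  apply le_antisymm
  · exact Nat.sInf_le hr
  · exact gD_le_of_reach (Nat.sInf_mem (s := {h | reach TStep h u v}) ⟨_, hr⟩)

theorem gD_comm {u v : List Bool} (h : u.length = v.length) : gD u v = gD v u := by
  rw [← tildeDist_eq h, ← tildeDist_eq h.symm, tildeDist_comm]

theorem tstep_iff {u v : List Bool} : tildeDist u v = 1 ↔ TStep u v := by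
  constructor
  · intro h
    have hm := Nat.sInf_mem (s := {h | reach TStep h u v}) (by
      by_contra hne
      rw [Set.not_nonempty_iff_eq_empty] at hne
      simp [tildeDist, hne] at h)
    change reach TStep (tildeDist u v) u v at hm
    rw [h] at hm
    obtain ⟨w, s, r⟩ := hm
    cases r
    exact s
  · intro h
    have hle : tildeDist u v ≤ 1 := Nat.sInf_le ⟨v, h, rfl⟩
    have hr := reach_gD _ u v rfl h.length.symm
    rw [← tildeDist_eq h.length] at hr
    rcases Nat.le_one_iff_eq_zero_or_eq_one.mp hle with h0 | h0
    · rw [h0] at hr; exact absurd hr h.ne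
    · exact h0

theorem reach_seq {step : List Bool → List Bool → Prop} : ∀ {h : ℕ} {u v : List Bool},
    reach step h u v → ∃ w : ℕ → List Bool, w 0 = u ∧ w h = v ∧ ∀ k < h, step (w k) (w (k+1)) := by
  intro h
  induction h with
  | zero => intro u v r; exact ⟨fun _ => u, rfl, r, by simp⟩
  | succ h ih =>
    intro u v ⟨z, s, r⟩
    obtain ⟨w, h0, h1, h2⟩ := ih r
    refine ⟨fun k => Nat.casesOn k u w, rfl, h1, ?_⟩
    intro k hk
    cases k with
    | zero => simpa [h0] using s
    | succ k => exact h2 k (by omega)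

theorem first_diff : ∀ {u v : List Bool}, u.length = v.length → u ≠ v →
    ∃ x y z a, u = x ++ a :: y ∧ v = x ++ (!a) :: z ∧ y.length = z.length
  | [], [], _, h => absurd rfl h
  | a :: u, b :: v, hl, hne => by
    simp at hl
    by_cases hab : a = b
    · subst hab
      obtain ⟨x, y, z, c, rfl, rfl, h⟩ := first_diff hl (by simpa using hne)
      exact ⟨a :: x, y, z, c, rfl, rfl, h⟩
    · obtain rfl : b = !a := by cases a <;> cases b <;> simp_all
      exact ⟨[], u, v, a, rfl, rfl, hl⟩

theorem gD_app (x : List Bool) {u v : List Bool} (h : u.length = v.length) :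
    gD (x ++ u) (x ++ v) = gD u v := by
  induction x with
  | nil => rfl
  | cons a x ih => simp only [List.cons_append]; rw [gD_same _ _ _ (by simp [h]), ih]

/-- The letter `0` can only be the last letter of `f`. -/
def ZeroLast (f : List Bool) : Prop := ∀ m l, f = m ++ false :: l → l = []

theorem ZeroLast.split {f : List Bool} (hf : ZeroLast f) {x y : List Bool}
    (h : f <:+: x ++ false :: y) : f <:+: x ++ [false] ∨ f <:+: y := by
  have : x ++ false :: y = (x ++ [false]) ++ y := by simp
  rw [this, List.infix_append_iff_ne_nil] at h
  rcases h with h | h | ⟨l₁, l₂, h1, h2, rfl, ⟨p, hp⟩, _⟩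
  · exact Or.inl h
  · exact Or.inr h
  · exfalso
    obtain ⟨m, c, rfl⟩ : ∃ m c, l₁ = m ++ [c] := ⟨_, _, (List.dropLast_append_getLast h1).symm⟩
    rw [← List.append_assoc] at hp
    have := (List.append_inj' hp rfl).2
    simp at this
    subst this
    exact h2 (hf m l₂ (by simp))

theorem zl_step {f : List Bool} (hf : ZeroLast f) {x y z : List Bool}
    (hl : y.length = z.length)
    (hu : ¬ f <:+: x ++ false :: y) (hv : ¬ f <:+: x ++ true :: z) :
    (∃ w, ¬ f <:+: w ∧ TStep (x ++ false :: y) w ∧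
      gD (x ++ false :: y) (x ++ true :: z) = gD w (x ++ true :: z) + 1) ∨
    (∃ w, ¬ f <:+: w ∧ TStep w (x ++ true :: z) ∧
      gD (x ++ false :: y) (x ++ true :: z) = gD (x ++ false :: y) w + 1) := by
  by_cases hn : ∃ u' v', y = true :: u' ∧ z = false :: v'
  · obtain ⟨y, z, rfl, rfl⟩ := hn
    simp at hl
    left
    refine ⟨x ++ true :: false :: y, ?_, by simpa using TStep.swap x y false, ?_⟩
    · intro h
      have e : x ++ true :: false :: y = (x ++ [true]) ++ false :: y := by simp
      rw [e] at h
      rcases hf.split h with h | h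
      · exact hv (h.trans ⟨[], z, by simp⟩)
      · exact hu (h.trans ⟨x ++ [false, true], [], by simp⟩)
    · rw [gD_app _ (by simp [hl]), gD_app _ (by simp [hl])]
      have := gD_swap false y z
      simp at this
      rw [this, gD_same _ _ _ (by simp [hl]), gD_same _ _ _ hl]; omega
  · right
    refine ⟨x ++ false :: z, ?_, by simpa using TStep.repl x z false, ?_⟩
    · intro h
      rcases hf.split h with h | h
      · exact hu (h.trans ⟨[], y, by simp⟩)
      · exact hv (h.trans ⟨x ++ [true], [], by simp⟩)
    · rw [gD_app _ (by simp [hl]), gD_app _ (by simp [hl])]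
      have := gD_repl false y z hl (by simpa using hn)
      simp at this
      rw [this, gD_same _ _ _ hl]; omega

theorem zl_reach {f : List Bool} (hf : ZeroLast f) : ∀ (d : ℕ) (u v : List Bool),
    u.length = v.length → gD u v = d → ¬ f <:+: u → ¬ f <:+: v →
    reach (fun a b => TStep a b ∧ ¬ f <:+: a ∧ ¬ f <:+: b) d u v := by
  intro d
  induction d with
  | zero =>
    intro u v hl h _ _
    have := reach_gD _ u v rfl hl.symm
    rw [h] at this
    exact this
  | succ d ih =>
    intro u v hl hd hu hv
    have hne : u ≠ v := by rintro rfl; rw [gD_self] at hd; omega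
    have key : (∃ w, ¬ f <:+: w ∧ TStep u w ∧ gD u v = gD w v + 1) ∨
        (∃ w, ¬ f <:+: w ∧ TStep w v ∧ gD u v = gD u w + 1) := by
      obtain ⟨x, y, z, a, rfl, rfl, h⟩ := first_diff hl hne
      cases a
      · exact zl_step hf h hu hv
      · rcases zl_step hf h.symm hv hu with ⟨w, h1, h2, h3⟩ | ⟨w, h1, h2, h3⟩
        · right
          refine ⟨w, h1, h2.symm, ?_⟩
          have g1 := gD_comm hl
          have g2 := gD_comm (hl.trans h2.length)
          simp only [Bool.not_true] at g1 g2 ⊢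
          omega
        · left
          refine ⟨w, h1, h2.symm, ?_⟩
          have g1 := gD_comm hl
          have g2 := gD_comm (h2.length.trans hl)
          simp only [Bool.not_true] at g1 g2 ⊢
          omega
    rcases key with ⟨w, h1, h2, h3⟩ | ⟨w, h1, h2, h3⟩
    · exact ⟨w, ⟨h2, hu, h1⟩, ih w v (by rw [← h2.length, hl]) (by omega) h1 hv⟩
    · exact reach_snoc (ih u w (by rw [h2.length, hl]) (by omega) hu h1) ⟨h2, h1, hv⟩

theorem zl_tilde {f : List Bool} (hf : ZeroLast f) : TildeIsometric f := by
  intro n _ u v hu hv h1 h2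
  have hl : u.length = v.length := by omega
  obtain ⟨w, w0, w1, w2⟩ := reach_seq (zl_reach hf _ u v hl rfl h1 h2)
  rw [tildeDist_eq hl]
  refine ⟨w, w0, w1, fun k hk => tstep_iff.2 (w2 k hk).1, ?_⟩
  intro k hk
  cases k with
  | zero => rwa [w0]
  | succ k => exact (w2 k (by omega)).2.2

/-- Transfer of tilde-isometricity along an involution. -/
theorem tilde_transfer (g : List Bool → List Bool) (hg : ∀ u, g (g u) = u)
    (hlen : ∀ u, (g u).length = u.length) (hs : ∀ u v, TStep u v → TStep (g u) (g v))
    (hi : ∀ u v, u <:+: v → g u <:+: g v) {f : List Bool} (h : TildeIsometric f) :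
    TildeIsometric (g f) := by
  have hr : ∀ d u v, reach TStep d u v → reach TStep d (g u) (g v) := by
    intro d
    induction d with
    | zero => intro u v r; exact congrArg g r
    | succ d ih => intro u v ⟨w, s, r⟩; exact ⟨g w, hs _ _ s, ih _ _ r⟩
  have hd : ∀ u v, tildeDist (g u) (g v) = tildeDist u v := by
    intro u v
    unfold tildeDist
    congr 1
    ext d
    refine ⟨fun r => ?_, fun r => hr _ _ _ r⟩
    have := hr _ _ _ r
    rwa [hg, hg] at this
  have hi' : ∀ u, ¬ g f <:+: u → ¬ f <:+: g u := by
    intro u hu h'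
    have := hi _ _ h'
    rw [hg] at this
    exact hu this
  intro n hn u v hu hv h1 h2
  obtain ⟨w, w0, w1, w2, w3⟩ := h n (by rwa [hlen] at hn) (g u) (g v) (by rw [hlen, hu])
    (by rw [hlen, hv]) (hi' _ h1) (hi' _ h2)
  rw [hd] at w1 w2 w3
  refine ⟨fun k => g (w k), by simp [w0, hg], by simp [w1, hg], ?_, ?_⟩
  · intro k hk; simp only [hd]; exact w2 k hk
  · intro k hk h'
    have := hi _ _ h'
    rw [hg, hg] at this
    exact w3 k hk this

theorem tilde_rev {f : List Bool} (h : TildeIsometric f) : TildeIsometric f.reverse := by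
  refine tilde_transfer List.reverse (by simp) (by simp) ?_ ?_ h
  · intro u v s
    cases s with
    | repl x y a => simpa using TStep.repl y.reverse x.reverse a
    | swap x y a => simpa using TStep.swap y.reverse x.reverse (!a)
  · intro u v; simp

theorem tilde_not {f : List Bool} (h : TildeIsometric f) : TildeIsometric (f.map not) := by
  refine tilde_transfer (List.map not) (by intro u; induction u <;> simp_all) (by simp) ?_ ?_ h
  · intro u v s
    cases s with
    | repl x y a => simpa using TStep.repl (x.map not) (y.map not) (!a)
    | swap x y a => simpa using TStep.swap (x.map not) (y.map not) (!a)
  · intro u v h; exact h.map not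

theorem zl_ones (k : ℕ) (l : List Bool) (hl : l.length ≤ 1) :
    ZeroLast (List.replicate k true ++ l) := by
  induction k with
  | zero =>
    intro m l' h
    simp at h
    have := congrArg List.length h
    simp at this
    exact List.length_eq_zero_iff.mp (by omega)
  | succ k ih =>
    intro m l' h
    cases m with
    | nil => simp [List.replicate_succ] at h
    | cons c m => simp [List.replicate_succ] at h; exact ih m l' (by simpa using h.2)

theorem not_ham_aux (b : Bool) : ¬ HamIsometric [b, !b, b] := by
  intro h
  obtain ⟨w, w0, w1, w2, w3, w4⟩ := h [b, !b, !b, b] [b, b, b, b] rfl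
    (by cases b <;> decide) (by cases b <;> decide)
  have e : hammDist [b, !b, !b, b] [b, b, b, b] = 2 := by cases b <;> decide
  rw [e] at w1 w2 w3 w4
  have l := w2 1 (by omega)
  have d1 := w3 0 (by omega)
  have d2 := w3 1 (by omega)
  have fr := w4 1 (by omega)
  simp only [Nat.zero_add, Nat.reduceAdd, w0, w1] at d1 d2
  generalize w 1 = t at *
  match t, l with
  | [p, q, r, s], _ =>
    clear w0 w1 w2 w3 w4 e h l
    revert b p q r s
    decide

theorem short_tilde (f : List Bool) (hf : f.length ≤ 3) (hh : HamIsometric f) :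
    TildeIsometric f := by
  have zl : ∀ k l, l.length ≤ 1 → TildeIsometric (List.replicate k true ++ l) :=
    fun k l h => zl_tilde (zl_ones k l h)
  match f, hf with
  | [], _ => exact zl 0 [] (by simp)
  | [true], _ => exact zl 1 [] (by simp)
  | [false], _ => exact zl 0 [false] (by simp)
  | [true, true], _ => exact zl 2 [] (by simp)
  | [true, false], _ => exact zl 1 [false] (by simp)
  | [false, true], _ => exact tilde_rev (zl 1 [false] (by simp))
  | [false, false], _ => exact tilde_not (zl 2 [] (by simp))
  | [true, true, true], _ => exact zl 3 [] (by simp)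
  | [true, true, false], _ => exact zl 2 [false] (by simp)
  | [false, true, true], _ => exact tilde_rev (zl 2 [false] (by simp))
  | [false, false, true], _ => exact tilde_not (zl 2 [false] (by simp))
  | [true, false, false], _ => exact tilde_not (tilde_rev (zl 2 [false] (by simp)))
  | [false, false, false], _ => exact tilde_not (zl 3 [] (by simp))
  | [true, false, true], _ => exact absurd hh (not_ham_aux true)
  | [false, true, false], _ => exact absurd hh (not_ham_aux false)

theorem not_tilde_1010 : ¬ TildeIsometric [true, false, true, false] := by
  intro h
  obtain ⟨w, w0, w1, w2, w3⟩ := h 5 (by simp) [false, true, true, false, false]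
    [true, false, false, true, false] rfl rfl (by decide) (by decide)
  have e : tildeDist [false, true, true, false, false] [true, false, false, true, false] = 2 := by
    rw [tildeDist_eq (by rfl)]; simp [gD]
  rw [e] at w1 w2 w3
  have d1 := w2 0 (by omega)
  have d2 := w2 1 (by omega)
  have fr := w3 1 (by omega)
  simp only [Nat.zero_add, Nat.reduceAdd, w0, w1] at d1 d2
  generalize w 1 = t at *
  have l := (tstep_iff.1 d1).length
  rw [tildeDist_eq l] at d1
  rw [tildeDist_eq (by rw [← l]; rfl)] at d2
  match t, l with
  | [p, q, r, s, t], _ =>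
    clear w0 w1 w2 w3 e h
    cases p <;> cases q <;> cases r <;> cases s <;> cases t <;>
      first | (simp [gD] at d1; done) | (simp [gD] at d2; done) |
        exact absurd fr (by decide)

theorem ham_set : ∀ (u v : List Bool) (i : ℕ) (a : Bool), u.length = v.length →
    u[i]? = some a → v[i]? = some (!a) →
    hammDist u (u.set i (!a)) = 1 ∧ hammDist u v = hammDist (u.set i (!a)) v + 1
  | [], _, i, a, _, h, _ => by simp at h
  | _ :: _, [], _, _, h, _, _ => by simp at h
  | c :: u, d :: v, 0, a, hl, h1, h2 => by
    simp at h1 h2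
    subst h1 h2
    have := hammDist_self u
    cases c <;> simp_all [hammDist, List.filter_cons]
  | c :: u, d :: v, i + 1, a, hl, h1, h2 => by
    simp at hl h1 h2
    obtain ⟨e1, e2⟩ := ham_set u v i a hl h1 h2
    cases c <;> cases d <;> simp_all [hammDist, List.filter_cons]

theorem ham_zero : ∀ (u v : List Bool), u.length = v.length → hammDist u v = 0 → u = v
  | [], [], _, _ => rfl
  | a :: u, b :: v, hl, h => by
    simp at hl
    have := ham_zero u v hl
    cases a <;> cases b <;> simp_all [hammDist, List.filter_cons]

theorem occ_iff (w : List Bool) : [true, false, true, false] <:+: w ↔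
    ∃ s, ∀ p, s ≤ p → p < s + 4 → w[p]? = some (decide ((p - s) % 2 = 0)) := by
  rw [List.infix_iff_getElem?]
  constructor
  · rintro ⟨s, _, h⟩
    refine ⟨s, fun p h1 h2 => ?_⟩
    obtain ⟨k, rfl⟩ := Nat.exists_eq_add_of_le' h1
    have hk : k < 4 := by omega
    rw [h k hk]
    interval_cases k <;> simp
  · rintro ⟨s, h⟩
    refine ⟨s, ?_, ?_⟩
    · have := h (s + 3) (by omega) (by omega)
      have := (List.getElem?_eq_some_iff.1 this).1
      simp; omega
    · intro k hk
      simp at hk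
      rw [h _ (by omega) (by omega)]
      interval_cases k <;> simp

theorem ham_flip {u v : List Bool} (hl : u.length = v.length) (hne : u ≠ v)
    (hu : ¬ [true, false, true, false] <:+: u) (hv : ¬ [true, false, true, false] <:+: v) :
    ∃ i a, u[i]? = some a ∧ v[i]? = some (!a) ∧
      ¬ [true, false, true, false] <:+: u.set i (!a) := by
  by_contra hcon
  push Not at hcon
  -- windows
  have W : ∀ i : ℕ, u[i]? ≠ v[i]? → ∃ s, s ≤ i ∧ i < s + 4 ∧
      u[i]? = some (decide ((i - s) % 2 = 1)) ∧ v[i]? = some (decide ((i - s) % 2 = 0)) ∧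
      (∀ p, s ≤ p → p < s + 4 → p ≠ i → u[p]? = some (decide ((p - s) % 2 = 0))) ∧
      ∃ j, j ≠ i ∧ s ≤ j ∧ j < s + 4 ∧ u[j]? ≠ v[j]? := by
    intro i hi
    have hil : i < u.length := by
      by_contra hc
      exact hi (by rw [List.getElem?_eq_none (by omega), List.getElem?_eq_none (by omega)])
    obtain ⟨a, ha⟩ : ∃ a, u[i]? = some a := ⟨_, List.getElem?_eq_getElem hil⟩
    obtain ⟨b, hb⟩ : ∃ b, v[i]? = some b := ⟨_, List.getElem?_eq_getElem (hl ▸ hil)⟩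
    obtain rfl : b = !a := by
      rw [ha, hb] at hi
      cases a <;> cases b <;> simp_all
    obtain ⟨s, hs⟩ := (occ_iff _).1 (hcon i a ha hb)
    have hs' : ∀ p, s ≤ p → p < s + 4 → p ≠ i → u[p]? = some (decide ((p - s) % 2 = 0)) := by
      intro p h1 h2 h3
      rw [← hs p h1 h2, List.getElem?_set_ne (Ne.symm h3)]
    have hin : s ≤ i ∧ i < s + 4 := by
      by_contra hc
      exact hu ((occ_iff _).2 ⟨s, fun p h1 h2 => hs' p h1 h2 (by rintro rfl; exact hc ⟨h1, h2⟩)⟩)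
    have hai := hs i hin.1 hin.2
    rw [List.getElem?_set_self hil] at hai
    refine ⟨s, hin.1, hin.2, ?_, by rw [hb, hai], hs', ?_⟩
    · rw [ha]
      simp at hai
      rcases Nat.mod_two_eq_zero_or_one (i - s) with h | h <;> simp_all
    · by_contra hc
      push Not at hc
      refine hv ((occ_iff _).2 ⟨s, fun p h1 h2 => ?_⟩)
      by_cases hp : p = i
      · subst hp; rw [hb, hai]
      · rw [← hc p hp h1 h2]; exact hs' p h1 h2 hp
  -- no two mutually covering windows
  have two : ∀ i j s t, i < j → s ≤ i → j < s + 4 → t ≤ i → j < t + 4 →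
      u[i]? = some (decide ((i - s) % 2 = 1)) →
      (∀ p, s ≤ p → p < s + 4 → p ≠ i → u[p]? = some (decide ((p - s) % 2 = 0))) →
      (∀ p, t ≤ p → p < t + 4 → p ≠ j → u[p]? = some (decide ((p - t) % 2 = 0))) → False := by
    intro i j s t hij h1 h2 h3 h4 h5 h6 h7
    have e := h7 i h3 (by omega) (by omega)
    rw [h5] at e
    simp at e
    obtain ⟨p, hp1, hp2, hp3, hp4, hp5, hp6⟩ : ∃ p, s ≤ p ∧ p < s + 4 ∧ t ≤ p ∧ p < t + 4 ∧
        p ≠ i ∧ p ≠ j := by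
      by_contra hc
      push Not at hc
      have c1 := hc (max s t)
      have c2 := hc (max s t + 1)
      have c3 := hc (max s t + 2)
      omega
    have e' := h6 p hp1 hp2 hp5
    rw [h7 p hp3 hp4 hp6] at e'
    simp at e'
    omega
  have bnd : ∀ i : ℕ, u[i]? ≠ v[i]? → i < u.length := by
    intro i hi
    by_contra hc
    exact hi (by rw [List.getElem?_eq_none (by omega), List.getElem?_eq_none (by omega)])
  have ex : ∃ i : ℕ, u[i]? ≠ v[i]? := by
    by_contra hc
    push Not at hc
    exact hne (List.ext_getElem? hc)
  let S : ℕ → Prop := fun i => u[i]? ≠ v[i]? ∧ ∃ s, s ≤ i ∧ i < s + 4 ∧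
      u[i]? = some (decide ((i - s) % 2 = 1)) ∧
      (∀ p, s ≤ p → p < s + 4 → p ≠ i → u[p]? = some (decide ((p - s) % 2 = 0))) ∧
      ∃ j, i < j ∧ j < s + 4 ∧ u[j]? ≠ v[j]?
  have S0 : ∃ i, S i := by
    classical
    refine ⟨Nat.find ex, Nat.find_spec ex, ?_⟩
    obtain ⟨s, a1, a2, a3, _, a4, j, b1, b2, b3, b4⟩ := W _ (Nat.find_spec ex)
    have := Nat.find_min' ex b4
    exact ⟨s, a1, a2, a3, a4, j, by omega, b3, b4⟩
  have S1 : ∀ i, S i → ∃ j, i < j ∧ S j := by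
    classical
    rintro i ⟨hi, s, a1, a2, a3, a4, hj⟩
    obtain ⟨c1, c2, c3⟩ := Nat.find_spec hj
    have c4 : ∀ k, i < k → k < s + 4 → u[k]? ≠ v[k]? → Nat.find hj ≤ k :=
      fun k x1 x2 x3 => Nat.find_min' hj ⟨x1, x2, x3⟩
    generalize Nat.find hj = j at *
    refine ⟨j, c1, c3, ?_⟩
    obtain ⟨t, d1, d2, d3, _, d4, k, e1, e2, e3, e4⟩ := W j c3
    refine ⟨t, d1, d2, d3, d4, k, ?_, e3, e4⟩
    by_contra hk
    have hki : k ≤ i := by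
      by_contra hk'
      have := c4 k (by omega) (by omega) e4
      omega
    exact two i j s t c1 a1 c2 (by omega) d2 a3 a4 d4
  obtain ⟨i0, h0⟩ := S0
  have grow : ∀ n, ∃ i, n ≤ i ∧ S i := by
    intro n
    induction n with
    | zero => exact ⟨i0, by omega, h0⟩
    | succ n ih =>
      obtain ⟨i, h1, h2⟩ := ih
      obtain ⟨j, h3, h4⟩ := S1 i h2
      exact ⟨j, by omega, h4⟩
  obtain ⟨i, h1, h2⟩ := grow u.length
  have := bnd i h2.1
  omega

theorem ham_reach : ∀ (d : ℕ) (u v : List Bool), u.length = v.length → hammDist u v = d →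
    ¬ [true, false, true, false] <:+: u → ¬ [true, false, true, false] <:+: v →
    reach (fun a b => b.length = v.length ∧ hammDist a b = 1 ∧
      ¬ [true, false, true, false] <:+: b) d u v := by
  intro d
  induction d with
  | zero => intro u v hl h _ _; exact ham_zero u v hl h
  | succ d ih =>
    intro u v hl hd hu hv
    obtain ⟨i, a, h1, h2, h3⟩ := ham_flip hl (by rintro rfl; rw [hammDist_self] at hd; omega) hu hv
    obtain ⟨e1, e2⟩ := ham_set u v i a hl h1 h2
    exact ⟨u.set i (!a), ⟨by simp [hl], e1, h3⟩, ih _ v (by simp [hl]) (by omega) h3 hv⟩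

theorem ham_1010 : HamIsometric [true, false, true, false] := by
  intro u v hl hu hv
  obtain ⟨w, w0, w1, w2⟩ := reach_seq (ham_reach _ u v hl rfl hu hv)
  refine ⟨w, w0, w1, ?_, fun k hk => (w2 k hk).2.1, ?_⟩
  · intro k hk
    cases k with
    | zero => rw [w0]
    | succ k => rw [(w2 k (by omega)).1, hl]
  · intro k hk
    cases k with
    | zero => rwa [w0]
    | succ k => exact (w2 k (by omega)).2.2

/-- `1010` is the shortest Ham-isometric word that is not tilde-isometric. -/
theorem shortest_ham_not_tilde :
    HamIsometric [true, false, true, false] ∧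
    ¬ TildeIsometric [true, false, true, false] ∧
    (∀ f : List Bool, f.length ≤ 3 → HamIsometric f → TildeIsometric f) :=
  ⟨ham_1010, not_tilde_1010, short_tilde⟩
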